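/- For every norm ‖·‖ on ℝⁿ with X = (ℝⁿ, ‖·‖), one has the identity 1 + β(X) = (1 + β(ℓ₂ⁿ))·(1 + β_σ(X)), where β_σ(X) = (∫_{S^{n−1}} ‖θ‖² dσ(θ))/(∫_{S^{n−1}} ‖θ‖ dσ(θ))² − 1; in particular β(X) ≥ β(ℓ₂ⁿ), where β(ℓ₂ⁿ) = Var‖Z‖₂/(E‖Z‖₂)² for Z ~ γ_n. -/

import Mathlib

open MeasureTheory ProbabilityTheory Real Set

/-- The standard Gaussian probability measure `γ_n` on `ℝⁿ`. -/
noncomputable def stdGaussian (n : ℕ) : Measure (EuclideanSpace ℝ (Fin n)) :=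
  (Measure.pi fun _ : Fin n => gaussianReal 0 1).map (EuclideanSpace.equiv (Fin n) ℝ).symm

/-- The rotation-invariant (uniform) probability measure `σ` on the Euclidean unit sphere
`S^{n−1}`, viewed as a measure on `ℝⁿ` supported on the sphere. -/
noncomputable def uniformSphere (n : ℕ) : Measure (EuclideanSpace ℝ (Fin n)) :=
  (((volume : Measure (EuclideanSpace ℝ (Fin n))).toSphere Set.univ)⁻¹ •
    (volume : Measure (EuclideanSpace ℝ (Fin n))).toSphere).map Subtype.val

/-- The normalized variance `β(X) = Var‖Z‖ / (E‖Z‖)²` of a norm `N` on `ℝⁿ`, `Z ~ γ_n`. -/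
noncomputable def gaussBeta {n : ℕ} (N : EuclideanSpace ℝ (Fin n) → ℝ) : ℝ :=
  variance N (stdGaussian n) / (∫ x, N x ∂stdGaussian n) ^ 2

/-- The spherical normalized variance
`β_σ(X) = (∫_{S^{n−1}} ‖θ‖² dσ)/(∫_{S^{n−1}} ‖θ‖ dσ)² − 1`. -/
noncomputable def sphereBeta {n : ℕ} (N : EuclideanSpace ℝ (Fin n) → ℝ) : ℝ :=
  (∫ θ, N θ ^ 2 ∂uniformSphere n) / (∫ θ, N θ ∂uniformSphere n) ^ 2 - 1


lemma pi_gauss_density (n : ℕ) : (Measure.pi fun _ : Fin n => gaussianReal 0 1) =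
    (volume : Measure (Fin n → ℝ)).withDensity
      (fun x => ENNReal.ofReal (∏ i, gaussianPDFReal 0 1 (x i))) := by
  refine Measure.pi_eq fun s hs => ?_
  rw [withDensity_apply _ (MeasurableSet.univ_pi hs), volume_pi, Measure.restrict_pi_pi,
    ← ofReal_integral_eq_lintegral_ofReal]
  · rw [integral_fintype_prod_eq_prod (fun _ => gaussianPDFReal 0 1),
      ENNReal.ofReal_prod_of_nonneg]
    · refine Finset.prod_congr rfl fun i _ => ?_
      rw [gaussianReal_apply_eq_integral _ one_ne_zero]
    · intro i _
      exact integral_nonneg fun x => gaussianPDFReal_nonneg _ _ _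
  · exact Integrable.fintype_prod (f := fun _ => gaussianPDFReal 0 1) fun i =>
      (integrable_gaussianPDFReal 0 1).restrict
  · exact Filter.Eventually.of_forall fun x =>
      Finset.prod_nonneg fun i _ => gaussianPDFReal_nonneg _ _ _

lemma prod_pdf (n : ℕ) (x : EuclideanSpace ℝ (Fin n)) :
    ∏ i, gaussianPDFReal 0 1 (x i) = (√(2 * π))⁻¹ ^ n * rexp (-‖x‖ ^ 2 / 2) := by
  simp only [gaussianPDFReal, Finset.prod_mul_distrib, Finset.prod_const, ← Real.exp_sum,
    EuclideanSpace.norm_sq_eq]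
  simp [Finset.sum_div, Finset.sum_neg_distrib, neg_div]

lemma integral_stdG (n : ℕ) (f : EuclideanSpace ℝ (Fin n) → ℝ) :
    ∫ x, f x ∂(_root_.stdGaussian n) =
      ∫ x : EuclideanSpace ℝ (Fin n), ((√(2 * π))⁻¹ ^ n * rexp (-‖x‖ ^ 2 / 2)) * f x := by
  have he : MeasurableEmbedding (EuclideanSpace.equiv (Fin n) ℝ).symm :=
    (EuclideanSpace.equiv (Fin n) ℝ).symm.toHomeomorph.measurableEmbedding
  rw [_root_.stdGaussian, he.integral_map, pi_gauss_density,
    integral_withDensity_eq_integral_toReal_smul (by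
      refine ENNReal.measurable_ofReal.comp (Finset.measurable_prod _ fun i _ => ?_)
      exact (measurable_gaussianPDFReal 0 1).comp (measurable_pi_apply i)) (by simp)]
  rw [← (PiLp.volume_preserving_toLp (Fin n)).integral_comp
    (MeasurableEquiv.toLp 2 (Fin n → ℝ)).measurableEmbedding]
  refine integral_congr_ae (Filter.Eventually.of_forall fun x => ?_)
  have h := prod_pdf n (WithLp.toLp 2 x)
  simp only at h ⊢
  rw [← h, ENNReal.toReal_ofReal (Finset.prod_nonneg fun i _ => gaussianPDFReal_nonneg _ _ _)]
  rfl

lemma integral_uS (n : ℕ) (f : EuclideanSpace ℝ (Fin n) → ℝ) :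
    ∫ x, f x ∂(uniformSphere n) =
      ((volume : Measure (EuclideanSpace ℝ (Fin n))).toSphere.real Set.univ)⁻¹ *
       ∫ x, f x.1 ∂(volume : Measure (EuclideanSpace ℝ (Fin n))).toSphere := by
  rw [uniformSphere, (MeasurableEmbedding.subtype_coe
    (Metric.isClosed_sphere.measurableSet)).integral_map, integral_smul_measure]
  simp [Measure.real]

instance probUS (n : ℕ) [NeZero n] : IsProbabilityMeasure (uniformSphere n) := by
  unfold uniformSphere
  have : (volume : Measure (EuclideanSpace ℝ (Fin n))).toSphere ≠ 0 := by
    have : 0 < n := Nat.pos_of_ne_zero (NeZero.ne n)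
    rw [Ne, Measure.toSphere_eq_zero_iff_finrank]
    simp [this.ne']
  have : NeZero ((volume : Measure (EuclideanSpace ℝ (Fin n))).toSphere) := ⟨this⟩
  exact Measure.isProbabilityMeasure_map measurable_subtype_coe.aemeasurable

lemma polar (n : ℕ) [NeZero n] (k : ℕ) : ∃ K : ℝ, ∀ f : EuclideanSpace ℝ (Fin n) → ℝ,
    (∀ r : ℝ, 0 < r → ∀ x, f (r • x) = r ^ k * f x) →
    ∫ x, f x ∂(_root_.stdGaussian n) = K * ∫ x, f x ∂(uniformSphere n) := by
  let E := EuclideanSpace ℝ (Fin n)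
  let μ : Measure E := volume
  have hS : μ.toSphere.real univ ≠ 0 := by
    have : 0 < n := Nat.pos_of_ne_zero (NeZero.ne n)
    have : μ.toSphere ≠ 0 := by
      rw [Ne, Measure.toSphere_eq_zero_iff_finrank]
      simp [E, this.ne']
    rw [Ne, measureReal_eq_zero_iff, Measure.measure_univ_eq_zero]
    exact this
  refine ⟨(∫ r : Ioi (0:ℝ), (√(2 * π))⁻¹ ^ n * rexp (-(r:ℝ) ^ 2 / 2) * (r:ℝ) ^ k
    ∂(Measure.volumeIoiPow (Module.finrank ℝ E - 1))) * μ.toSphere.real univ, fun f hf => ?_⟩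
  rw [integral_uS, integral_stdG]
  have h1 : ∫ x : E, ((√(2 * π))⁻¹ ^ n * rexp (-‖x‖ ^ 2 / 2)) * f x =
      ∫ x : ({(0)}ᶜ : Set E), ((√(2 * π))⁻¹ ^ n * rexp (-‖x.1‖ ^ 2 / 2)) * f x.1
        ∂(μ.comap (↑)) := by
    have : Nontrivial E := by
      have : Nonempty (Fin n) := ⟨0⟩
      infer_instance
    rw [integral_subtype_comap (measurableSet_singleton _).compl
      fun x : E ↦ ((√(2 * π))⁻¹ ^ n * rexp (-‖x‖ ^ 2 / 2)) * f x,
        restrict_compl_singleton]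
  have h2 : ∫ x : ({(0)}ᶜ : Set E), ((√(2 * π))⁻¹ ^ n * rexp (-‖x.1‖ ^ 2 / 2)) * f x.1
        ∂(μ.comap (↑)) = ∫ z, f z.1.1 *
          ((√(2 * π))⁻¹ ^ n * rexp (-(z.2:ℝ) ^ 2 / 2) * (z.2:ℝ) ^ k)
          ∂(μ.toSphere.prod (.volumeIoiPow (Module.finrank ℝ E - 1))) := by
    rw [← μ.measurePreserving_homeomorphUnitSphereProd.integral_comp
        (Homeomorph.measurableEmbedding _)]
    refine integral_congr_ae (Filter.Eventually.of_forall fun x => ?_)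
    have hx : 0 < ‖x.1‖ := norm_pos_iff.2 x.2
    have := hf ‖x.1‖ hx (‖x.1‖⁻¹ • x.1)
    rw [smul_smul, mul_inv_cancel₀ hx.ne', one_smul] at this
    simp only [homeomorphUnitSphereProd_apply_fst_coe, homeomorphUnitSphereProd_apply_snd_coe]
    rw [this]
    ring
  have h3 := integral_prod_mul (μ := μ.toSphere)
    (ν := Measure.volumeIoiPow (Module.finrank ℝ E - 1)) (fun z => f z.1)
    (fun r : Ioi (0:ℝ) => (√(2 * π))⁻¹ ^ n * rexp (-(r:ℝ) ^ 2 / 2) * (r:ℝ) ^ k)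
  rw [h1, h2, h3]
  change _ = _ * μ.toSphere.real univ * ((μ.toSphere.real univ)⁻¹ * _)
  rw [mul_assoc, mul_inv_cancel_left₀ hS, mul_comm]

lemma polar' (n : ℕ) [NeZero n] (k : ℕ) (f : EuclideanSpace ℝ (Fin n) → ℝ)
    (hf : ∀ r : ℝ, 0 < r → ∀ x, f (r • x) = r ^ k * f x) :
    ∫ x, f x ∂(_root_.stdGaussian n) =
      (∫ x, ‖x‖ ^ k ∂(_root_.stdGaussian n)) * ∫ x, f x ∂(uniformSphere n) := by
  obtain ⟨K, hK⟩ := polar n k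
  have h2 := hK (fun x => ‖x‖ ^ k) (fun r hr x => by
    rw [norm_smul, Real.norm_of_nonneg hr.le, mul_pow])
  have h3 : ∫ x : EuclideanSpace ℝ (Fin n), ‖x‖ ^ k ∂(uniformSphere n) = 1 := by
    have hae : ∀ᵐ x ∂(uniformSphere n), ‖x‖ ^ k = (1:ℝ) := by
      rw [uniformSphere, (MeasurableEmbedding.subtype_coe
        (Metric.isClosed_sphere.measurableSet)).ae_map_iff]
      exact Filter.Eventually.of_forall fun x => by simp
    rw [integral_congr_ae hae]
    simp
  rw [h2, h3, mul_one]
  exact hK f hf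

lemma stdG_eq (n : ℕ) : _root_.stdGaussian n =
    ProbabilityTheory.stdGaussian (EuclideanSpace ℝ (Fin n)) := by
  rw [← map_pi_eq_stdGaussian]
  rfl

instance probSG (n : ℕ) : IsProbabilityMeasure (_root_.stdGaussian n) := by
  rw [stdG_eq]; infer_instance

lemma memLp_norm_SG (n : ℕ) : MemLp (fun x : EuclideanSpace ℝ (Fin n) => ‖x‖) 2
    (_root_.stdGaussian n) := by
  rw [stdG_eq]
  exact (IsGaussian.memLp_id _ 2 (by simp)).norm

lemma one_add_gaussBeta {n : ℕ} (N : EuclideanSpace ℝ (Fin n) → ℝ)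
    (hN : MemLp N 2 (_root_.stdGaussian n)) (h0 : ∫ x, N x ∂(_root_.stdGaussian n) ≠ 0) :
    1 + gaussBeta N =
      (∫ x, N x ^ 2 ∂(_root_.stdGaussian n)) / (∫ x, N x ∂(_root_.stdGaussian n)) ^ 2 := by
  rw [gaussBeta, variance_eq_sub hN]
  simp only [Pi.pow_apply]
  field_simp
  ring

/-- For every norm `N` on `ℝⁿ`:
`1 + β(X) = (1 + β(ℓ₂ⁿ))·(1 + β_σ(X))`; in particular `β(X) ≥ β(ℓ₂ⁿ)`. -/
theorem one_add_beta_factorization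
    (n : ℕ) (hn : 0 < n) (N : EuclideanSpace ℝ (Fin n) → ℝ)
    (hpos : ∀ x, x ≠ 0 → 0 < N x)
    (hhom : ∀ (a : ℝ) (x), N (a • x) = |a| * N x)
    (htri : ∀ x y, N (x + y) ≤ N x + N y) :
    1 + gaussBeta N =
      (1 + gaussBeta (fun x : EuclideanSpace ℝ (Fin n) => ‖x‖)) * (1 + sphereBeta N) ∧
    gaussBeta (fun x : EuclideanSpace ℝ (Fin n) => ‖x‖) ≤ gaussBeta N := by
  have : NeZero n := ⟨hn.ne'⟩
  have hN0 : N 0 = 0 := by simpa using hhom 0 0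
  have hnn : ∀ x, 0 ≤ N x := fun x => by
    by_cases hx : x = 0
    · rw [hx, hN0]
    · exact (hpos x hx).le
  have hcont : Continuous N := by
    have hc : ConvexOn ℝ univ N := ⟨convex_univ, fun x _ y _ a b ha hb _ => by
      refine (htri _ _).trans ?_
      rw [hhom, hhom, abs_of_nonneg ha, abs_of_nonneg hb]
      rfl⟩
    exact hc.locallyLipschitz.continuous
  obtain ⟨C, hC⟩ : ∃ C, ∀ x ∈ Metric.sphere (0 : EuclideanSpace ℝ (Fin n)) 1, ‖N x‖ ≤ C :=
    (isCompact_sphere _ _).exists_bound_of_continuousOn hcont.continuousOn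
  have hbd : ∀ x, N x ≤ C * ‖x‖ := fun x => by
    by_cases hx : x = 0
    · simp [hx, hN0]
    · have hx' : 0 < ‖x‖ := norm_pos_iff.2 hx
      have h := hC (‖x‖⁻¹ • x) (by simp [norm_smul, hx'.ne'])
      have h' := (le_abs_self _).trans h
      rw [hhom, abs_of_pos (inv_pos.2 hx'), inv_mul_le_iff₀ hx'] at h'
      linarith
  have hmem : MemLp N 2 (_root_.stdGaussian n) := by
    refine ((memLp_norm_SG n).const_mul C).mono hcont.aestronglyMeasurable
      (Filter.Eventually.of_forall fun x => ?_)
    rw [Real.norm_of_nonneg (hnn x)]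
    exact (hbd x).trans (le_abs_self _)
  have hmemS : MemLp N 2 (uniformSphere n) := by
    refine MemLp.of_bound hcont.aestronglyMeasurable C ?_
    rw [uniformSphere, (MeasurableEmbedding.subtype_coe
        (Metric.isClosed_sphere.measurableSet)).ae_map_iff]
    exact Filter.Eventually.of_forall fun x => hC _ x.2
  have hSpos : 0 < ∫ x, N x ∂(uniformSphere n) := by
    rw [integral_pos_iff_support_of_nonneg hnn (hmemS.integrable (by norm_num))]
    have : ∀ᵐ x ∂(uniformSphere n), x ∈ Function.support N := by
      rw [uniformSphere, (MeasurableEmbedding.subtype_coe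
        (Metric.isClosed_sphere.measurableSet)).ae_map_iff]
      refine Filter.Eventually.of_forall fun x => (hpos _ ?_).ne'
      exact ne_zero_of_mem_unit_sphere x
    have h1 : uniformSphere n (Function.support N) = 1 :=
      (prob_compl_eq_zero_iff₀ hcont.isOpen_support.measurableSet.nullMeasurableSet).1
        (mem_ae_iff.1 this)
    rw [h1]
    exact one_pos
  have hGpos : 0 < ∫ x : EuclideanSpace ℝ (Fin n), ‖x‖ ∂(_root_.stdGaussian n) := by
    refine lt_of_le_of_ne (integral_nonneg fun x => norm_nonneg x) fun h => ?_
    have h2 := (integral_eq_zero_iff_of_nonneg (fun x => norm_nonneg x)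
      ((memLp_norm_SG n).integrable (by norm_num))).1 h.symm
    have h3 : ∀ᵐ x ∂(_root_.stdGaussian n), x ≠ 0 := by
      have he : MeasurableEmbedding (EuclideanSpace.equiv (Fin n) ℝ).symm :=
        (EuclideanSpace.equiv (Fin n) ℝ).symm.toHomeomorph.measurableEmbedding
      rw [_root_.stdGaussian, he.ae_map_iff]
      have : NullSingletonClass (gaussianReal 0 1) := nullSingletonClass_gaussianReal one_ne_zero
      have : Nonempty (Fin n) := ⟨0⟩
      have : NullSingletonClass (Measure.pi fun _ : Fin n => gaussianReal 0 1) := inferInstance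
      filter_upwards [Measure.ae_ne (Measure.pi fun _ : Fin n => gaussianReal 0 1) 0] with x hx
      simpa using hx
    obtain ⟨x, hx, hx'⟩ := (h2.and h3).exists
    exact hx' (norm_eq_zero.1 hx)
  have e1 := polar' n 1 N (fun r hr x => by rw [hhom, abs_of_pos hr, pow_one])
  have e2 := polar' n 2 (fun x => N x ^ 2) (fun r hr x => by
    rw [hhom, abs_of_pos hr, mul_pow])
  simp only [pow_one] at e1
  have b1 := one_add_gaussBeta N hmem (by rw [e1]; positivity)
  have b2 := one_add_gaussBeta (fun x : EuclideanSpace ℝ (Fin n) => ‖x‖) (memLp_norm_SG n) hGpos.ne'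
  have key : 1 + gaussBeta N =
      (1 + gaussBeta (fun x : EuclideanSpace ℝ (Fin n) => ‖x‖)) * (1 + sphereBeta N) := by
    rw [b1, b2, e1, e2, sphereBeta]
    field_simp
    ring
  refine ⟨key, ?_⟩
  have hs : 0 ≤ sphereBeta N := by
    have hv := variance_nonneg N (uniformSphere n)
    rw [variance_eq_sub hmemS] at hv
    simp only [Pi.pow_apply] at hv
    rw [sphereBeta, sub_nonneg, one_le_div (by positivity)]
    linarith
  have hg : 0 ≤ gaussBeta (fun x : EuclideanSpace ℝ (Fin n) => ‖x‖) :=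
    div_nonneg (variance_nonneg _ _) (sq_nonneg _)
  nlinarith
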